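/- Let n ≥ 2 and let ℙ be a partial order with property K_n. Then the poset ℋ_{ℙ,n} of finite n-linked subsets of ℙ ordered by reverse inclusion has precaliber ω₁: every uncountable subset of ℋ_{ℙ,n} has an uncountable centered subset. -/

import Mathlib

/-- `X ⊆ P` is `n`-linked: every set of at most `n` elements of `X` has a common lower bound. -/
def IsNLinked {P : Type*} [PartialOrder P] (n : ℕ) (X : Set P) : Prop :=
  ∀ s : Finset P, ↑s ⊆ X → s.card ≤ n → ∃ p, ∀ q ∈ s, p ≤ q

/-- `F` is a member of `ℋ_{ℙ,n}`: a finite `n`-linked subset of `ℙ`. -/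
def MemHPn {P : Type*} [PartialOrder P] (n : ℕ) (F : Finset P) : Prop :=
  ∀ s ⊆ F, s.card ≤ n → ∃ p, ∀ q ∈ s, p ≤ q

theorem IsNLinked.mono {P : Type*} [PartialOrder P] {n : ℕ} {X Y : Set P}
    (hY : IsNLinked n Y) (hXY : X ⊆ Y) : IsNLinked n X :=
  fun s hs hn => hY s (hs.trans hXY) hn

/-- In a poset with property `K_n`, any function on an uncountable set has `n`-linked image on
some uncountable subset, whether or not it is injective. -/
theorem exists_uncountable_isNLinked_image {P ι : Type*} [PartialOrder P] {n : ℕ}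
    (hK : ∀ X : Set P, ¬X.Countable → ∃ Y ⊆ X, ¬Y.Countable ∧ IsNLinked n Y)
    (f : ι → P) {A : Set ι} (hA : ¬A.Countable) :
    ∃ B ⊆ A, ¬B.Countable ∧ IsNLinked n (f '' B) := by
  by_cases hf : (f '' A).Countable
  · obtain ⟨y, -, hy⟩ : ∃ y ∈ f '' A, ¬(A ∩ f ⁻¹' {y}).Countable := by
      by_contra! h
      refine hA ((hf.biUnion h).mono fun a ha => ?_)
      exact Set.mem_biUnion (Set.mem_image_of_mem f ha) ⟨ha, rfl⟩
    refine ⟨_, Set.inter_subset_left, hy, fun s hs _ => ⟨y, fun q hq => ?_⟩⟩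
    obtain ⟨a, ⟨-, ha⟩, rfl⟩ := hs hq
    exact ge_of_eq ha
  · obtain ⟨Y, hYA, hY, hlink⟩ := hK _ hf
    refine ⟨A ∩ f ⁻¹' Y, Set.inter_subset_left, fun h => hY ((h.image f).mono fun y hy => ?_),
      hlink.mono ?_⟩
    · obtain ⟨a, ha, rfl⟩ := hYA hy
      exact ⟨a, ⟨ha, hy⟩, rfl⟩
    · rintro _ ⟨a, ⟨-, ha⟩, rfl⟩
      exact ha

/-- Finitely many functions can be treated simultaneously in
`exists_uncountable_isNLinked_image`. -/
theorem exists_uncountable_forall_isNLinked_image {P ι κ : Type*} [PartialOrder P] {n : ℕ}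
    (hK : ∀ X : Set P, ¬X.Countable → ∃ Y ⊆ X, ¬Y.Countable ∧ IsNLinked n Y)
    (f : κ → ι → P) (S : Finset κ) {A : Set ι} (hA : ¬A.Countable) :
    ∃ B ⊆ A, ¬B.Countable ∧ ∀ k ∈ S, IsNLinked n (f k '' B) := by
  classical
  induction S using Finset.induction_on with
  | empty => exact ⟨A, subset_rfl, hA, by simp⟩
  | insert k S _ ih =>
    obtain ⟨B, hBA, hB, hlink⟩ := ih
    obtain ⟨C, hCB, hC, hk⟩ := exists_uncountable_isNLinked_image hK (f k) hB
    refine ⟨C, hCB.trans hBA, hC, fun j hj => ?_⟩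
    obtain rfl | hj := Finset.mem_insert.mp hj
    · exact hk
    · exact (hlink j hj).mono (Set.image_mono hCB)

/-- An uncountable family of finite `n`-linked sets of the same size has an uncountable subfamily
whose union is `n`-linked. -/
theorem exists_uncountable_isNLinked_biUnion {P : Type*} [PartialOrder P] {n : ℕ}
    (hK : ∀ X : Set P, ¬X.Countable → ∃ Y ⊆ X, ¬Y.Countable ∧ IsNLinked n Y)
    {m : ℕ} {A : Set (Finset P)} (hmem : ∀ F ∈ A, MemHPn n F) (hcard : ∀ F ∈ A, F.card = m)
    (hA : ¬A.Countable) :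
    ∃ B ⊆ A, ¬B.Countable ∧ IsNLinked n (⋃ F ∈ B, (F : Set P)) := by
  classical
  let e (F : A) : Fin m ≃ (F : Finset P) := (Finset.equivFinOfCardEq (hcard F F.2)).symm
  have hbound (s : {s : Finset (Fin m) // s.card ≤ n}) (F : A) :
      ∃ p, ∀ i ∈ s.1, p ≤ (e F i : P) := by
    obtain ⟨p, hp⟩ := hmem F F.2 (s.1.image fun i => (e F i : P))
      (Finset.image_subset_iff.mpr fun i _ => (e F i).2) (Finset.card_image_le.trans s.2)
    exact ⟨p, fun i hi => hp _ (Finset.mem_image_of_mem _ hi)⟩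
  choose r hr using hbound
  have huniv : ¬(Set.univ : Set A).Countable := by
    rwa [Set.countable_univ_iff, Set.countable_coe_iff]
  obtain ⟨B, -, hB, hlink⟩ :=
    exists_uncountable_forall_isNLinked_image hK r Finset.univ huniv
  refine ⟨Subtype.val '' B, Subtype.coe_image_subset A B,
    fun h => hB (Set.countable_of_injective_of_countable_image Subtype.val_injective.injOn h),
    fun S hS hSn => ?_⟩
  have hpick (q : S) : ∃ F ∈ B, ∃ i, (e F i : P) = q := by
    obtain ⟨_, ⟨F, hF, rfl⟩, hq⟩ := Set.mem_iUnion₂.mp (hS q.2)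
    exact ⟨F, hF, (e F).symm ⟨q, hq⟩, by simp⟩
  choose F hFB i hi using hpick
  let s : {s : Finset (Fin m) // s.card ≤ n} :=
    ⟨Finset.univ.image i, Finset.card_image_le.trans (by simpa using hSn)⟩
  obtain ⟨p, hp⟩ := hlink s (Finset.mem_univ s) (Finset.univ.image fun q => r s (F q))
    (by
      intro x hx
      obtain ⟨q, -, rfl⟩ := Finset.mem_image.mp hx
      exact ⟨F q, hFB q, rfl⟩)
    (Finset.card_image_le.trans (by simpa using hSn))
  refine ⟨p, fun q hq => ?_⟩
  exact ((hp _ (Finset.mem_image_of_mem _ (Finset.mem_univ _))).trans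
    (hr s _ _ (Finset.mem_image_of_mem _ (Finset.mem_univ _)))).trans_eq (hi ⟨q, hq⟩)

/-- If `n ≥ 2` and `ℙ` has property K_n, then the poset `ℋ_{ℙ,n}` of finite `n`-linked
subsets of `ℙ` (ordered by reverse inclusion) has precaliber `ω₁`: every uncountable
subset of `ℋ_{ℙ,n}` has an uncountable centered subset (any finitely many members have a
common lower bound in `ℋ_{ℙ,n}`, i.e. a common superset lying in `ℋ_{ℙ,n}`). -/
theorem HPn_precaliber
    (P : Type*) [PartialOrder P] (n : ℕ) (hn : 2 ≤ n)
    (hK : ∀ X : Set P, ¬X.Countable → ∃ Y ⊆ X, ¬Y.Countable ∧ IsNLinked n Y) :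
    ∀ 𝒳 : Set (Finset P), (∀ F ∈ 𝒳, MemHPn n F) → ¬𝒳.Countable →
      ∃ 𝒴 ⊆ 𝒳, ¬𝒴.Countable ∧
        ∀ t : Finset (Finset P), ↑t ⊆ 𝒴 →
          ∃ H : Finset P, MemHPn n H ∧ ∀ F ∈ t, F ⊆ H := by
  classical
  intro 𝒳 hmem h𝒳
  obtain ⟨m, hm⟩ : ∃ m, ¬{F ∈ 𝒳 | F.card = m}.Countable := by
    by_contra! h
    refine h𝒳 ((Set.countable_iUnion h).mono fun F hF => ?_)
    exact Set.mem_iUnion.mpr ⟨F.card, hF, rfl⟩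
  obtain ⟨𝒴, h𝒴, hunc, hlink⟩ := exists_uncountable_isNLinked_biUnion hK
    (fun F hF => hmem F hF.1) (fun F hF => hF.2) hm
  refine ⟨𝒴, fun F hF => (h𝒴 hF).1, hunc, fun t ht => ⟨t.biUnion id, ?_, fun F hF =>
    Finset.subset_biUnion_of_mem id hF⟩⟩
  refine fun s hs => hlink s fun q hq => ?_
  obtain ⟨F, hF, hqF⟩ := Finset.mem_biUnion.mp (hs hq)
  exact Set.mem_biUnion (ht hF) hqF
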